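/- Let γ₁ ≤ γ₂ < 0. Then for every probability measure μ on ℝ, the infinite-horizon reservation levels x^γ_∞(μ) := sup_{n ≥ 1} x^γ_n(μ) of the exponential-utility Bayesian house selling problem satisfy x^{γ₁}_∞(μ) ≤ x^{γ₂}_∞(μ); that is, the infinite-horizon reservation levels are increasing in the risk-aversion parameter γ. -/

import Mathlib

open MeasureTheory

/-- The distribution `Q_μ` of the next offer given the conditional distribution `μ` of the
unknown parameter: the measure on `ℝ` with `λ`-density `x ↦ ∫ q(x,θ) μ(dθ)`. -/
noncomputable def offerMeasure (lam : Measure ℝ) (q : ℝ → ℝ → ℝ) (μ : Measure ℝ) :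
    Measure ℝ :=
  lam.withDensity fun x => ENNReal.ofReal (∫ θ, q x θ ∂μ)

/-- The Bayes updating operator `Φ(x, μ)`: the measure with `μ`-density
`θ ↦ q(x,θ) / ∫ q(x,θ') μ(dθ')` when the denominator is positive, and `μ` otherwise. -/
noncomputable def bayesUpdate (q : ℝ → ℝ → ℝ) (x : ℝ) (μ : Measure ℝ) : Measure ℝ :=
  if 0 < ∫ θ, q x θ ∂μ then
    μ.withDensity fun θ => ENNReal.ofReal (q x θ / ∫ θ', q x θ' ∂μ)
  else μ

/-- The reservation levels of the exponential-utility Bayesian house selling problem;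
`resLevel lam q c γ n μ` is the reservation level `x^γ_{n+1}(μ)` with `n+1` remaining
stages:  `x^γ_1(μ) = −c + (1/γ)·ln ∫ e^{γx} Q_μ(dx)` and
`x^γ_{n+1}(μ) = −c + (1/γ)·ln ∫ e^{γ·max{x, x^γ_n(Φ(x,μ))}} Q_μ(dx)`. -/
noncomputable def resLevel (lam : Measure ℝ) (q : ℝ → ℝ → ℝ) (c γ : ℝ) :
    ℕ → Measure ℝ → ℝ
  | 0, μ => -c + (1 / γ) * Real.log (∫ x, Real.exp (γ * x) ∂(offerMeasure lam q μ))
  | n + 1, μ => -c + (1 / γ) * Real.log (∫ x,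
      Real.exp (γ * max x (resLevel lam q c γ n (bayesUpdate q x μ)))
        ∂(offerMeasure lam q μ))

namespace ProbabilityTheory

variable {Ω : Type*} [MeasurableSpace Ω] {P : Measure Ω} {X Y : Ω → ℝ} {a b s t : ℝ}

/-- Monotonicity of the entropic certainty equivalent in the risk parameter. -/
lemma one_div_mul_cgf_mono_param [IsProbabilityMeasure P] (hst : s ≤ t) (ht : t < 0)
    (hs_int : Integrable (fun ω => Real.exp (s * X ω)) P)
    (ht_int : Integrable (fun ω => Real.exp (t * X ω)) P) :
    1 / s * cgf X P s ≤ 1 / t * cgf X P t := by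
  have hs : s < 0 := hst.trans_lt ht
  have hp : 1 ≤ s / t := by rwa [one_le_div_of_neg ht]
  have hpow : (fun ω => Real.exp (t * X ω) ^ (s / t)) = fun ω => Real.exp (s * X ω) := by
    ext ω
    rw [← Real.exp_mul]
    congr 1
    field_simp [ht.ne]
  have hJensen : mgf X P t ^ (s / t) ≤ mgf X P s := by
    have h := (convexOn_rpow hp).map_integral_le (μ := P)
      (f := fun ω => Real.exp (t * X ω))
      (Real.continuous_rpow_const (by linarith)).continuousOn isClosed_Ici
      (.of_forall fun ω => (Real.exp_pos _).le) ht_int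
      (by simpa only [Function.comp_def, hpow] using hs_int)
    simpa only [hpow, mgf] using h
  have hlog : s / t * cgf X P t ≤ cgf X P s := by
    rw [cgf, cgf, ← Real.log_rpow (mgf_pos ht_int)]
    exact Real.log_le_log (Real.rpow_pos_of_pos (mgf_pos ht_int) _) hJensen
  calc 1 / s * cgf X P s ≤ 1 / s * (s / t * cgf X P t) :=
        mul_le_mul_of_nonpos_left hlog (one_div_nonpos.2 hs.le)
    _ = 1 / t * cgf X P t := by field_simp [hs.ne, ht.ne]

lemma one_div_mul_cgf_mono [IsProbabilityMeasure P] (ht : t < 0) (hXY : X ≤ᵐ[P] Y)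
    (hX : Integrable (fun ω => Real.exp (t * X ω)) P)
    (hY : Integrable (fun ω => Real.exp (t * Y ω)) P) :
    1 / t * cgf X P t ≤ 1 / t * cgf Y P t :=
  mul_le_mul_of_nonpos_left
    (Real.log_le_log (mgf_pos hY) (mgf_anti_of_nonpos hXY ht.le hX))
    (one_div_nonpos.2 ht.le)

lemma one_div_mul_cgf_mem_Icc [IsProbabilityMeasure P] (ht : t < 0) (hX : AEMeasurable X P)
    (hb : ∀ᵐ ω ∂P, X ω ∈ Set.Icc a b) :
    1 / t * cgf X P t ∈ Set.Icc a b := by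
  have hconst (r : ℝ) : 1 / t * cgf (fun _ : Ω => r) P t = r := by
    rw [cgf_const]
    field_simp [ht.ne]
  have hX_int := integrable_exp_mul_of_mem_Icc (t := t) hX hb
  constructor
  · rw [← hconst a]
    exact one_div_mul_cgf_mono ht (hb.mono fun ω h => h.1) (integrable_const _) hX_int
  · rw [← hconst b]
    exact one_div_mul_cgf_mono ht (hb.mono fun ω h => h.2) hX_int (integrable_const _)

end ProbabilityTheory

section HouseSelling

variable {lam : Measure ℝ} {q : ℝ → ℝ → ℝ} {m M c γ γ₁ γ₂ : ℝ} {μ : Measure ℝ}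

lemma isProbabilityMeasure_offerMeasure [SigmaFinite lam]
    (hq : Measurable (Function.uncurry q)) (hqnn : ∀ x θ, 0 ≤ q x θ)
    (hqdens : ∀ θ, ∫ x, q x θ ∂lam = 1) [IsProbabilityMeasure μ] :
    IsProbabilityMeasure (offerMeasure lam q μ) := by
  have hmeas : Measurable (Function.uncurry fun x θ => ENNReal.ofReal (q x θ)) :=
    hq.ennreal_ofReal
  have hone (θ : ℝ) : ∫⁻ x, ENNReal.ofReal (q x θ) ∂lam = 1 := by
    rw [← ofReal_integral_eq_lintegral_ofReal (integrable_of_integral_eq_one (hqdens θ))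
      (.of_forall fun x => hqnn x θ), hqdens, ENNReal.ofReal_one]
  have htotal : ∫⁻ x, ∫⁻ θ, ENNReal.ofReal (q x θ) ∂μ ∂lam = 1 := by
    rw [lintegral_lintegral_swap hmeas.aemeasurable]
    simp [hone]
  have hfinite : ∀ᵐ x ∂lam, ∫⁻ θ, ENNReal.ofReal (q x θ) ∂μ < ⊤ :=
    ae_lt_top hmeas.lintegral_prod_right (by simp [htotal])
  constructor
  rw [offerMeasure, withDensity_apply _ MeasurableSet.univ, Measure.restrict_univ, ← htotal]
  refine lintegral_congr_ae ?_
  filter_upwards [hfinite] with x hx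
  have hqx : Measurable (q x) := hq.comp measurable_prodMk_left
  exact ofReal_integral_eq_lintegral_ofReal
    ((lintegral_ofReal_ne_top_iff_integrable hqx.aestronglyMeasurable
      (.of_forall (hqnn x))).1 hx.ne) (.of_forall (hqnn x))

lemma ae_offerMeasure_mem_Icc [SFinite μ] (hq : Measurable (Function.uncurry q))
    (hqsupp : ∀ x θ, x ∉ Set.Icc m M → q x θ = 0) :
    ∀ᵐ x ∂offerMeasure lam q μ, x ∈ Set.Icc m M := by
  have hdens : Measurable fun x => ENNReal.ofReal (∫ θ, q x θ ∂μ) :=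
    (hq.stronglyMeasurable.integral_prod_right (ν := μ)).measurable.ennreal_ofReal
  rw [offerMeasure, ae_withDensity_iff hdens]
  refine .of_forall fun x hx => ?_
  by_contra hxm
  exact hx (by simp [hqsupp x _ hxm])

lemma isProbabilityMeasure_bayesUpdate (hqnn : ∀ x θ, 0 ≤ q x θ) [IsProbabilityMeasure μ]
    (x : ℝ) : IsProbabilityMeasure (bayesUpdate q x μ) := by
  rw [bayesUpdate]
  split_ifs with h
  · have hq_int : Integrable (q x) μ := .of_integral_ne_zero h.ne'
    constructor
    rw [withDensity_apply _ MeasurableSet.univ, Measure.restrict_univ,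
      ← ofReal_integral_eq_lintegral_ofReal (hq_int.div_const _)
        (.of_forall fun θ => div_nonneg (hqnn x θ) h.le),
      integral_div, div_self h.ne', ENNReal.ofReal_one]
  · infer_instance

lemma resLevel_zero (μ : Measure ℝ) :
    resLevel lam q c γ 0 μ =
      -c + 1 / γ * ProbabilityTheory.cgf id (offerMeasure lam q μ) γ :=
  rfl

lemma resLevel_succ (n : ℕ) (μ : Measure ℝ) :
    resLevel lam q c γ (n + 1) μ =
      -c + 1 / γ * ProbabilityTheory.cgf
        (fun x => max x (resLevel lam q c γ n (bayesUpdate q x μ)))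
        (offerMeasure lam q μ) γ :=
  rfl

lemma ae_max_resLevel_mem_Icc [SFinite μ] {n : ℕ} (hq : Measurable (Function.uncurry q))
    (hqsupp : ∀ x θ, x ∉ Set.Icc m M → q x θ = 0)
    (hle : ∀ x, resLevel lam q c γ n (bayesUpdate q x μ) ≤ M) :
    ∀ᵐ x ∂offerMeasure lam q μ,
      max x (resLevel lam q c γ n (bayesUpdate q x μ)) ∈ Set.Icc m M := by
  filter_upwards [ae_offerMeasure_mem_Icc hq hqsupp] with x hx
  exact ⟨hx.1.trans (le_max_left _ _), max_le hx.2 (hle x)⟩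

lemma resLevel_le
    [SigmaFinite lam] (hq : Measurable (Function.uncurry q)) (hqnn : ∀ x θ, 0 ≤ q x θ)
    (hqdens : ∀ θ, ∫ x, q x θ ∂lam = 1) (hqsupp : ∀ x θ, x ∉ Set.Icc m M → q x θ = 0)
    (hc : 0 < c)
    (hmeas : ∀ γ : ℝ, γ < 0 → ∀ (n : ℕ) (μ : Measure ℝ), IsProbabilityMeasure μ →
      Measurable fun x => resLevel lam q c γ n (bayesUpdate q x μ))
    (hγ : γ < 0) (n : ℕ) (μ : Measure ℝ) [IsProbabilityMeasure μ] :
    resLevel lam q c γ n μ ≤ M := by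
  induction n generalizing μ with
  | zero =>
    have := isProbabilityMeasure_offerMeasure (μ := μ) hq hqnn hqdens
    have h := ProbabilityTheory.one_div_mul_cgf_mem_Icc hγ aemeasurable_id
      (ae_offerMeasure_mem_Icc (lam := lam) (μ := μ) hq hqsupp)
    rw [resLevel_zero]
    exact (add_le_of_nonpos_left (by linarith)).trans h.2
  | succ n ih =>
    have := isProbabilityMeasure_offerMeasure (μ := μ) hq hqnn hqdens
    have hle (x : ℝ) : resLevel lam q c γ n (bayesUpdate q x μ) ≤ M :=
      have := isProbabilityMeasure_bayesUpdate (μ := μ) hqnn x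
      ih _
    have h := ProbabilityTheory.one_div_mul_cgf_mem_Icc hγ
      (measurable_id.max (hmeas γ hγ n μ inferInstance)).aemeasurable
      (ae_max_resLevel_mem_Icc hq hqsupp hle)
    rw [resLevel_succ]
    exact (add_le_of_nonpos_left (by linarith)).trans h.2

lemma resLevel_mono_gamma
    [SigmaFinite lam] (hq : Measurable (Function.uncurry q)) (hqnn : ∀ x θ, 0 ≤ q x θ)
    (hqdens : ∀ θ, ∫ x, q x θ ∂lam = 1) (hqsupp : ∀ x θ, x ∉ Set.Icc m M → q x θ = 0)
    (hc : 0 < c)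
    (hmeas : ∀ γ : ℝ, γ < 0 → ∀ (n : ℕ) (μ : Measure ℝ), IsProbabilityMeasure μ →
      Measurable fun x => resLevel lam q c γ n (bayesUpdate q x μ))
    (h₁₂ : γ₁ ≤ γ₂) (h₂ : γ₂ < 0) (n : ℕ) (μ : Measure ℝ)
    [IsProbabilityMeasure μ] :
    resLevel lam q c γ₁ n μ ≤ resLevel lam q c γ₂ n μ := by
  have h₁ : γ₁ < 0 := h₁₂.trans_lt h₂
  induction n generalizing μ with
  | zero =>
    have := isProbabilityMeasure_offerMeasure (μ := μ) hq hqnn hqdens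
    have hexp (t : ℝ) := ProbabilityTheory.integrable_exp_mul_of_mem_Icc (t := t)
      aemeasurable_id (ae_offerMeasure_mem_Icc (lam := lam) (μ := μ) hq hqsupp)
    rw [resLevel_zero, resLevel_zero]
    refine add_le_add_right ?_ (-c)
    exact ProbabilityTheory.one_div_mul_cgf_mono_param h₁₂ h₂ (hexp γ₁) (hexp γ₂)
  | succ n ih =>
    have := isProbabilityMeasure_offerMeasure (μ := μ) hq hqnn hqdens
    have := isProbabilityMeasure_bayesUpdate (μ := μ) hqnn
    have hexp {γ : ℝ} (hγ : γ < 0) (t : ℝ) :=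
      ProbabilityTheory.integrable_exp_mul_of_mem_Icc (t := t)
        (measurable_id.max (hmeas γ hγ n μ inferInstance)).aemeasurable
        (ae_max_resLevel_mem_Icc hq hqsupp fun x =>
          resLevel_le hq hqnn hqdens hqsupp hc hmeas hγ n (bayesUpdate q x μ))
    rw [resLevel_succ, resLevel_succ]
    refine add_le_add_right ?_ (-c)
    exact (ProbabilityTheory.one_div_mul_cgf_mono_param h₁₂ h₂ (hexp h₁ γ₁) (hexp h₁ γ₂)).trans
      (ProbabilityTheory.one_div_mul_cgf_mono h₂
        (.of_forall fun x => max_le_max_left x (ih (bayesUpdate q x μ)))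
        (hexp h₁ γ₂) (hexp h₂ γ₂))

end HouseSelling

/-- The infinite-horizon reservation levels `x^γ_∞(μ) = sup_{n ≥ 1} x^γ_n(μ)` of the
exponential-utility Bayesian house selling problem are increasing in the risk-aversion
parameter: if `γ₁ ≤ γ₂ < 0` then `x^{γ₁}_∞(μ) ≤ x^{γ₂}_∞(μ)`
(here `resLevel lam q c γ n = x^γ_{n+1}`, so `⨆ n, resLevel lam q c γ n μ = x^γ_∞(μ)`). -/
theorem resLevel_infinite_horizon_increasing_in_gamma
    (lam : Measure ℝ) [SigmaFinite lam] (m M : ℝ) (hmM : m < M)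
    (q : ℝ → ℝ → ℝ) (hq : Measurable (Function.uncurry q))
    (hqnn : ∀ x θ, 0 ≤ q x θ)
    (hqdens : ∀ θ, ∫ x, q x θ ∂lam = 1)
    (hqsupp : ∀ x θ, x ∉ Set.Icc m M → q x θ = 0)
    (c : ℝ) (hc : 0 < c)
    (hmeas : ∀ γ : ℝ, γ < 0 → ∀ (n : ℕ) (μ : Measure ℝ), IsProbabilityMeasure μ →
      Measurable fun x => resLevel lam q c γ n (bayesUpdate q x μ))
    (γ₁ γ₂ : ℝ) (h₁₂ : γ₁ ≤ γ₂) (h₂ : γ₂ < 0) :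
    ∀ (μ : Measure ℝ), IsProbabilityMeasure μ →
      (⨆ n : ℕ, resLevel lam q c γ₁ n μ) ≤ (⨆ n : ℕ, resLevel lam q c γ₂ n μ) := by
  intro μ _
  refine ciSup_mono ⟨M, ?_⟩ fun n =>
    resLevel_mono_gamma hq hqnn hqdens hqsupp hc hmeas h₁₂ h₂ n μ
  rintro _ ⟨n, rfl⟩
  exact resLevel_le hq hqnn hqdens hqsupp hc hmeas h₂ n μ
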